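/- Assume γ_i > 0 for all 0 ≤ i ≤ d, and equip G := G(B,γ) with the partial order g ≥ h :⟺ g − h ∈ Σ_{i=0}^d ℤ_{≥0}x_i (the elements x_0,…,x_d satisfy (G1)–(G3), so this is a partial order). Then: (i) for every non-trivial upper set I ⊆ G, the set J(I) := I ∩ ((G ∖ I) + p) belongs to 𝒥; (ii) the map I ↦ f_{J(I)} from the set of non-trivial upper sets of G to the set of cut detectors of type γ is surjective; and (iii) for non-trivial upper sets I, I' one has f_{J(I)} = f_{J(I')} if and only if I' = I + np for some n ∈ ℤ. (Equivalently, via the bijection between cut detectors and cuts, non-trivial upper sets of G surject onto cuts of Q of type γ, with fibers the ℤp-translation classes.) -/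

import Mathlib

open scoped Classical

noncomputable section

namespace Paper

/-- The ambient lattice `ℤ^(d+1)`. -/
abbrev V (d : ℕ) : Type := Fin (d + 1) → ℤ

/-- The coordinate-sum homomorphism. -/
def sumHom (d : ℕ) : V d →+ ℤ :=
  AddMonoidHom.mk' (fun v => ∑ i, v i) (fun a b => by
    simp [Finset.sum_add_distrib])

/-- The lattice `L` of integer vectors with coordinate sum zero. -/
def L (d : ℕ) : AddSubgroup (V d) := (sumHom d).ker

/-- `α i = e_i - e_{i-1}` (indices cyclic mod `d+1`), as an element of `L`. -/
def alpha (d : ℕ) (i : Fin (d + 1)) : L d :=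
  ⟨Pi.single i 1 - Pi.single (i - 1) 1, by
    have : sumHom d (Pi.single i 1 - Pi.single (i - 1) 1) = 0 := by
      simp [sumHom, Finset.sum_sub_distrib, Pi.single_apply]
    exact this⟩

/-- Arrows of the infinite quiver `Q̂`: the pair (source, type); the arrow of type `i`
with source `x` goes from `x` to `x + α i`. -/
abbrev ArrowHat (d : ℕ) : Type := L d × Fin (d + 1)

/-- Arrows of the quiver `Q` on `L/B`: the pair (source, type). -/
abbrev Arrow (d : ℕ) (B : AddSubgroup (L d)) : Type := (L d ⧸ B) × Fin (d + 1)

/-- The preimage among arrows of `Q̂` of a set of arrows of `Q`. -/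
def preim (d : ℕ) (B : AddSubgroup (L d)) (C : Set (Arrow d B)) : Set (ArrowHat d) :=
  {a | ((QuotientAddGroup.mk a.1 : L d ⧸ B), a.2) ∈ C}

/-- A set of arrows of `Q̂` is a cut if it contains exactly one arrow of every elementary
cycle.  Elementary cycles are exactly the cyclic paths of length `d+1` with pairwise distinct
types; they are parametrized by a starting vertex `x` and a permutation `σ` of the types,
the `k`-th arrow being the type-`σ k` arrow with source `x + ∑_{j<k} α (σ j)`. -/
def IsCutHat (d : ℕ) (Ch : Set (ArrowHat d)) : Prop :=
  ∀ (x : L d) (σ : Equiv.Perm (Fin (d + 1))),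
    ∃! k : Fin (d + 1), (x + ∑ j ∈ Finset.Iio k, alpha d (σ j), σ k) ∈ Ch

/-- A set of arrows of `Q̂` is `B`-periodic if it is invariant under translation by `B`. -/
def IsBPeriodic (d : ℕ) (B : AddSubgroup (L d)) (Ch : Set (ArrowHat d)) : Prop :=
  ∀ (a : ArrowHat d) (b : L d), b ∈ B → ((a.1 + b, a.2) ∈ Ch ↔ a ∈ Ch)

/-- A set of arrows of `Q` is a cut if its preimage among the arrows of `Q̂` is a cut. -/
def IsCut (d : ℕ) (B : AddSubgroup (L d)) (C : Set (Arrow d B)) : Prop :=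
  IsCutHat d (preim d B C)

/-- The type of a cut of `Q`: the `i`-th entry is the number of arrows of type `i` in it. -/
def cutType (d : ℕ) (B : AddSubgroup (L d)) (C : Set (Arrow d B)) : Fin (d + 1) → ℤ :=
  fun i => (Nat.card {v : L d ⧸ B // (v, i) ∈ C} : ℤ)

/-- A cut detector of type `γ`. -/
def IsCutDetector (d : ℕ) (B : AddSubgroup (L d)) (f : L d ⧸ B → ℤ)
    (γ : Fin (d + 1) → ℤ) : Prop :=
  f 0 = 0 ∧ ∀ (x : L d) (i : Fin (d + 1)),
    f (QuotientAddGroup.mk (x + alpha d i)) = f (QuotientAddGroup.mk x) + γ i ∨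
    f (QuotientAddGroup.mk (x + alpha d i)) = f (QuotientAddGroup.mk x) + γ i - (B.index : ℤ)

/-- The value `f_C` of an arrow of `Q̂`: `γ i - m` if the arrow lies in the given set of
arrows, and `γ i` otherwise (for an arrow of type `i`). -/
def arrowVal (d : ℕ) (Ch : Set (ArrowHat d)) (γ : Fin (d + 1) → ℤ) (m : ℤ)
    (a : ArrowHat d) : ℤ :=
  if a ∈ Ch then γ a.2 - m else γ a.2

/-- The value `f_C` of a path in `Q̂`, the path being recorded as its list of types together
with its source: the sum of the values of its arrows. -/
def pathVal (d : ℕ) (Ch : Set (ArrowHat d)) (γ : Fin (d + 1) → ℤ) (m : ℤ) :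
    List (Fin (d + 1)) → L d → ℤ
  | [], _ => 0
  | i :: p, x => arrowVal d Ch γ m (x, i) + pathVal d Ch γ m p (x + alpha d i)

/-- `f` is the function `f̄_C` induced by `f_C` on `L/B`:  for every `x ∈ L` and every path
`p` in `Q̂` from `0` to `x`, `f(x + B)` is the value of `p`. -/
def Detects (d : ℕ) (B : AddSubgroup (L d)) (C : Set (Arrow d B)) (γ : Fin (d + 1) → ℤ)
    (f : L d ⧸ B → ℤ) : Prop :=
  ∀ (x : L d) (p : List (Fin (d + 1))), (p.map (alpha d)).sum = x →
    f (QuotientAddGroup.mk x) = pathVal d (preim d B C) γ (B.index : ℤ) p 0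

/-- The set of arrows `C_f` of `Q` associated to a function `f : L/B → ℤ` (of type `γ`):
the arrows `x + B → x + α i + B` with `f(x + α i + B) = f(x + B) + γ i - m`. -/
def cutOf (d : ℕ) (B : AddSubgroup (L d)) (f : L d ⧸ B → ℤ) (γ : Fin (d + 1) → ℤ) :
    Set (Arrow d B) :=
  {a | ∃ x : L d, QuotientAddGroup.mk x = a.1 ∧
      f (QuotientAddGroup.mk (x + alpha d a.2)) = f a.1 + γ a.2 - (B.index : ℤ)}


/-- A path in the quiver `Q_C = Q ∖ C`, recorded as its list of types plus its source:
all its arrows avoid `C`. -/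
def avoids (d : ℕ) (B : AddSubgroup (L d)) (C : Set (Arrow d B)) :
    List (Fin (d + 1)) → (L d ⧸ B) → Prop
  | [], _ => True
  | i :: p, v => (v, i) ∉ C ∧ avoids d B C p (v + QuotientAddGroup.mk (alpha d i))

/-- A cut `C` of `Q` is bounding if the quiver `Q_C` obtained by deleting the arrows of `C`
has no cyclic path of positive length. -/
def IsBounding (d : ℕ) (B : AddSubgroup (L d)) (C : Set (Arrow d B)) : Prop :=
  ¬ ∃ (v : L d ⧸ B) (p : List (Fin (d + 1))), p ≠ [] ∧ avoids d B C p v ∧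
      v + QuotientAddGroup.mk ((p.map (alpha d)).sum) = v

/-- The homomorphism `Φ : ℤ^(d+1) → ℤ ⊕ L/B` with `Φ(e_i) = (γ_i, α_i + B)`. -/
def Phi (d : ℕ) (B : AddSubgroup (L d)) (γ : Fin (d + 1) → ℤ) :
    V d →+ ℤ × (L d ⧸ B) :=
  AddMonoidHom.mk'
    (fun v => (∑ i, v i * γ i, QuotientAddGroup.mk (∑ i, v i • alpha d i)))
    (fun a b => by
      have h1 : ∑ i, (a + b) i * γ i = (∑ i, a i * γ i) + ∑ i, b i * γ i := by
        rw [← Finset.sum_add_distrib]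
        exact Finset.sum_congr rfl fun i _ => by simp [add_mul]
      have h2 : (∑ i, (a + b) i • alpha d i) =
          (∑ i, a i • alpha d i) + ∑ i, b i • alpha d i := by
        rw [← Finset.sum_add_distrib]
        exact Finset.sum_congr rfl fun i _ => by simp [add_smul]
      show (∑ i, (a + b) i * γ i, QuotientAddGroup.mk (∑ i, (a + b) i • alpha d i)) =
        ((∑ i, a i * γ i, QuotientAddGroup.mk (∑ i, a i • alpha d i)) : ℤ × (L d ⧸ B)) +
          (∑ i, b i * γ i, QuotientAddGroup.mk (∑ i, b i • alpha d i))
      rw [Prod.mk_add_mk, h1, h2, QuotientAddGroup.mk_add])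

/-- The group `G(B,γ)`, the image of `Φ`. -/
abbrev GB (d : ℕ) (B : AddSubgroup (L d)) (γ : Fin (d + 1) → ℤ) :
    AddSubgroup (ℤ × (L d ⧸ B)) :=
  (Phi d B γ).range

/-- The element `x_i = Φ(e_i)` of `G(B,γ)`. -/
def xE (d : ℕ) (B : AddSubgroup (L d)) (γ : Fin (d + 1) → ℤ) (i : Fin (d + 1)) :
    GB d B γ :=
  ⟨Phi d B γ (Pi.single i 1), ⟨Pi.single i 1, rfl⟩⟩

/-- The element `p = ∑ x_i` of `G(B,γ)`. -/
def pE (d : ℕ) (B : AddSubgroup (L d)) (γ : Fin (d + 1) → ℤ) : GB d B γ :=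
  ∑ i, xE d B γ i

/-- Membership in `𝒥`: `J` contains exactly one element of every coset of `ℤp`, and for
`g ∈ J` and every `i`, `g + x_i ∈ J ∪ (J + p)`. -/
def InJ (d : ℕ) (B : AddSubgroup (L d)) (γ : Fin (d + 1) → ℤ)
    (J : Set (GB d B γ)) : Prop :=
  (∀ g : GB d B γ, ∃! n : ℤ, g + n • pE d B γ ∈ J) ∧
    ∀ g ∈ J, ∀ i : Fin (d + 1), g + xE d B γ i ∈ J ∨ g + xE d B γ i - pE d B γ ∈ J

/-- `f` is the function `f_J : L/B → ℤ` attached to `J ∈ 𝒥`:  whenever `n_J • p ∈ J`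
and `g ∈ J`, the value of `f` at the image of `g` under the second projection is
`π₁(g) - n_J · m`. -/
def IsFJ (d : ℕ) (B : AddSubgroup (L d)) (γ : Fin (d + 1) → ℤ)
    (J : Set (GB d B γ)) (f : L d ⧸ B → ℤ) : Prop :=
  ∀ n : ℤ, n • pE d B γ ∈ J → ∀ g ∈ J,
    f (g : ℤ × (L d ⧸ B)).2 = (g : ℤ × (L d ⧸ B)).1 - n * (B.index : ℤ)

/-- The cone of nonnegative integer combinations of the `x i`. -/
def cone {G : Type*} [AddCommGroup G] {n : ℕ} (x : Fin n → G) : Set G :=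
  {g | ∃ c : Fin n → ℕ, g = ∑ i, (c i : ℤ) • x i}

/-- Upper sets for the partial order `g ≤ h ↔ h - g ∈ cone x`. -/
def IsUpper {G : Type*} [AddCommGroup G] {n : ℕ} (x : Fin n → G) (I : Set G) : Prop :=
  ∀ g ∈ I, ∀ h : G, h - g ∈ cone x → h ∈ I

/-- `J(I) = I ∩ (Iᶜ + p)`. -/
def JofI {G : Type*} [AddCommGroup G] (p : G) (I : Set G) : Set G :=
  {g | g ∈ I ∧ g - p ∉ I}

/-- The set `𝒥̃` of subsets `J` with `g ≱ h + p` for all `g, h ∈ J` (where `p = ∑ x i`). -/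
def tilJSet {G : Type*} [AddCommGroup G] {n : ℕ} (x : Fin n → G) : Set (Set G) :=
  {J | ∀ g ∈ J, ∀ h ∈ J, g - (h + ∑ i, x i) ∉ cone x}

/-- The homomorphism `ℤ^(d+1) → G` sending `e_i` to `x i`. -/
def PhiG {G : Type*} [AddCommGroup G] (d : ℕ) (x : Fin (d + 1) → G) : V d →+ G :=
  AddMonoidHom.mk' (fun v => ∑ i, v i • x i) (fun a b => by
    rw [← Finset.sum_add_distrib]
    exact Finset.sum_congr rfl fun i _ => by simp [add_smul])

/-- A finitely generated abelian group of rank one with elements `x_0, …, x_d`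
satisfying (G1), (G2), (G3).  (Rank one is expressed by the existence of a surjective
homomorphism to `ℤ` whose kernel is exactly the torsion.) -/
def GoodPair (d : ℕ) (G : Type*) [AddCommGroup G] (x : Fin (d + 1) → G) : Prop :=
  AddGroup.FG G ∧
  (∃ π' : G →+ ℤ, Function.Surjective π' ∧ ∀ g : G, π' g = 0 ↔ IsOfFinAddOrder g) ∧
  (∀ i, x i ≠ 0) ∧
  (∀ g : G, ∃ c : Fin (d + 1) → ℤ, g = ∑ i, c i • x i) ∧
  (∀ g : G, g ∈ cone x → -g ∈ cone x → g = 0)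

/-- A pair `(B, γ)` of a finite-index subgroup `B ⊆ L` and a positive integer vector `γ`
satisfying the two conditions of Theorem `chartype`. -/
def GoodBgamma (d : ℕ) (B : AddSubgroup (L d)) (γ : Fin (d + 1) → ℤ) : Prop :=
  B.FiniteIndex ∧ (∀ i, 0 < γ i) ∧ (∑ i, γ i) = (B.index : ℤ) ∧
    ∀ m' : Fin (d + 1) → ℤ, (∑ i, m' i • alpha d i) ∈ B →
      (B.index : ℤ) ∣ ∑ i, m' i * γ i

theorem cone_of_nonneg {G : Type*} [AddCommGroup G] {n : ℕ} (x : Fin n → G) (c : Fin n → ℤ)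
    (hc : ∀ i, 0 ≤ c i) : ∑ i, c i • x i ∈ cone x :=
  ⟨fun i => (c i).toNat, Finset.sum_congr rfl fun i _ => by rw [Int.toNat_of_nonneg (hc i)]⟩

theorem exists_add_mem_cone {G : Type*} [AddCommGroup G] {n : ℕ} (x : Fin n → G)
    (hx : ∀ g : G, ∃ c : Fin n → ℤ, g = ∑ i, c i • x i) (g : G) :
    ∃ N : ℤ, ∀ k : ℤ, N ≤ k → g + k • ∑ i, x i ∈ cone x := by
  obtain ⟨c, rfl⟩ := hx g
  refine ⟨∑ i, |c i|, fun k hk => ?_⟩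
  have : ∑ i, c i • x i + k • ∑ i, x i = ∑ i, (c i + k) • x i := by
    simp [add_smul, Finset.sum_add_distrib, Finset.smul_sum]
  rw [this]
  apply cone_of_nonneg
  intro i
  have h1 : |c i| ≤ ∑ i, |c i| :=
    Finset.single_le_sum (f := fun i => |c i|) (fun i _ => abs_nonneg _) (Finset.mem_univ i)
  have := neg_abs_le (c i)
  linarith

theorem smul_p_mem_cone {G : Type*} [AddCommGroup G] {n : ℕ} (x : Fin n → G) (k : ℤ)
    (hk : 0 ≤ k) : k • ∑ i, x i ∈ cone x := by
  rw [Finset.smul_sum]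
  exact cone_of_nonneg x (fun _ => k) (fun _ => hk)

theorem x_mem_cone {G : Type*} [AddCommGroup G] {n : ℕ} (x : Fin n → G) (i : Fin n) :
    x i ∈ cone x := by
  have h := cone_of_nonneg x (Pi.single i 1) (fun j => by
    by_cases h : j = i
    · subst h; simp
    · simp [h])
  simpa [Pi.single_apply, ite_smul] using h

theorem p_sub_x_mem_cone {G : Type*} [AddCommGroup G] {n : ℕ} (x : Fin n → G) (i : Fin n) :
    ∑ j, x j - x i ∈ cone x := by
  have h := cone_of_nonneg x (fun j => 1 - (Pi.single i 1 : Fin n → ℤ) j) (fun j => by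
    by_cases h : j = i
    · subst h; simp
    · simp [h])
  simpa [Pi.single_apply, sub_smul, ite_smul, Finset.sum_sub_distrib] using h

theorem upper_threshold {G : Type*} [AddCommGroup G] {n : ℕ} (x : Fin n → G)
    (hx : ∀ g : G, ∃ c : Fin n → ℤ, g = ∑ i, c i • x i) (I : Set G) (hI : IsUpper x I)
    (hne : I.Nonempty) (hnu : I ≠ Set.univ) (g : G) :
    ∃ n : ℤ, ∀ k : ℤ, g + k • (∑ i, x i) ∈ I ↔ n ≤ k := by
  obtain ⟨a, ha⟩ := hne
  obtain ⟨b, hb⟩ := (Set.ne_univ_iff_exists_notMem I).1 hnu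
  obtain ⟨N, hN⟩ := exists_add_mem_cone x hx (g - a)
  obtain ⟨M, hM⟩ := exists_add_mem_cone x hx (b - g)
  have h1 : ∃ k : ℤ, g + k • (∑ i, x i) ∈ I := ⟨N, hI a ha _ (by
    have := hN N le_rfl
    rwa [show g + N • ∑ i, x i - a = g - a + N • ∑ i, x i by abel])⟩
  have h2 : ∀ k : ℤ, g + k • (∑ i, x i) ∈ I → -M ≤ k := by
    intro k hk
    by_contra hlt
    apply hb
    refine hI _ hk b ?_
    have := hM (-k) (by linarith)
    rwa [show b - (g + k • ∑ i, x i) = b - g + (-k) • ∑ i, x i by rw [neg_smul]; abel]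
  obtain ⟨n, hn, hmin⟩ := Int.exists_least_of_bdd ⟨-M, h2⟩ h1
  refine ⟨n, fun k => ⟨hmin k, fun hk => hI _ hn _ ?_⟩⟩
  rw [show g + k • (∑ i, x i) - (g + n • ∑ i, x i) = (k - n) • ∑ i, x i by rw [sub_smul]; abel]
  exact smul_p_mem_cone x _ (by linarith)

theorem sum_alpha (d : ℕ) : ∑ i, alpha d i = 0 := by
  apply Subtype.ext
  rw [AddSubgroup.val_finsetSum]
  simp only [alpha, Finset.sum_sub_distrib, ZeroMemClass.coe_zero]
  rw [sub_eq_zero]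
  exact ((Equiv.subRight (1 : Fin (d+1))).sum_comp (fun i => (Pi.single i 1 : V d))).symm

theorem alpha_gen (d : ℕ) (v : L d) : ∃ c : Fin (d + 1) → ℤ, ∑ i, c i • alpha d i = v := by
  refine ⟨fun j => - ∑ k, if k < j then v.1 k else 0, ?_⟩
  have hv : ∑ k, v.1 k = 0 := v.2
  apply Subtype.ext
  rw [AddSubgroup.val_finsetSum]
  funext j
  simp only [AddSubgroup.coe_zsmul, alpha, Finset.sum_apply, Pi.smul_apply, Pi.sub_apply,
    smul_eq_mul, mul_sub, Finset.sum_sub_distrib, Pi.single_apply]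
  have e : ∀ i : Fin (d+1), j = i - 1 ↔ i = j + 1 := fun i => by
    rw [eq_sub_iff_add_eq]; exact eq_comm
  simp only [e, mul_ite, mul_one, mul_zero, Finset.sum_ite_eq, Finset.sum_ite_eq',
    Finset.mem_univ, if_true]
  rcases Fin.eq_castSucc_or_eq_last j with ⟨i, rfl⟩ | rfl
  · rw [Fin.coeSucc_eq_succ, neg_sub_neg, ← Finset.sum_sub_distrib]
    rw [Finset.sum_eq_single (Fin.castSucc i)]
    · simp
    · intro b _ hb
      have : (b < i.succ) ↔ (b < i.castSucc) := by
        simp only [Fin.lt_def, Fin.ext_iff, Fin.val_succ, Fin.val_castSucc, ne_eq] at *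
        omega
      simp [this]
    · simp
  · rw [Fin.last_add_one]
    simp only [Fin.not_lt_zero, if_false, Finset.sum_const_zero, neg_zero, sub_zero]
    rw [Fin.sum_univ_castSucc] at hv ⊢
    simp [Fin.castSucc_lt_last]
    linarith

section
variable (d : ℕ) (B : AddSubgroup (L d)) (γ : Fin (d + 1) → ℤ)

theorem xE_fst (i : Fin (d + 1)) : (xE d B γ i : ℤ × (L d ⧸ B)).1 = γ i := by
  simp [xE, Phi, Pi.single_apply]

theorem xE_snd (i : Fin (d + 1)) :
    (xE d B γ i : ℤ × (L d ⧸ B)).2 = QuotientAddGroup.mk (alpha d i) := by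
  simp [xE, Phi, Pi.single_apply, ite_smul]

theorem GB_gen (g : GB d B γ) : ∃ c : Fin (d + 1) → ℤ, g = ∑ i, c i • xE d B γ i := by
  obtain ⟨_, v, rfl⟩ := g
  refine ⟨v, Subtype.ext ?_⟩
  rw [AddSubgroup.val_finsetSum]
  conv_lhs => rw [show v = ∑ i, v i • Pi.single i (1 : ℤ) by
    funext j; simp [Finset.sum_apply, Pi.single_apply]]
  simp only [map_sum, map_zsmul]
  rfl

theorem comb_fst (c : Fin (d + 1) → ℤ) :
    ((∑ i, c i • xE d B γ i : GB d B γ) : ℤ × (L d ⧸ B)).1 = ∑ i, c i * γ i := by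
  rw [AddSubgroup.val_finsetSum, Prod.fst_sum]
  simp [xE_fst]

theorem comb_snd (c : Fin (d + 1) → ℤ) :
    ((∑ i, c i • xE d B γ i : GB d B γ) : ℤ × (L d ⧸ B)).2 =
      QuotientAddGroup.mk (∑ i, c i • alpha d i) := by
  rw [AddSubgroup.val_finsetSum, Prod.snd_sum]
  simp [xE_snd]

theorem pE_fst (hsum : (∑ i, γ i) = (B.index : ℤ)) :
    (pE d B γ : ℤ × (L d ⧸ B)).1 = B.index := by
  have := comb_fst d B γ (fun _ => 1)
  simpa [pE, hsum] using this

theorem pE_snd : (pE d B γ : ℤ × (L d ⧸ B)).2 = 0 := by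
  have := comb_snd d B γ (fun _ => 1)
  simpa [pE, sum_alpha] using this

theorem exists_over (q : L d ⧸ B) : ∃ g : GB d B γ, (g : ℤ × (L d ⧸ B)).2 = q := by
  obtain ⟨v, rfl⟩ := QuotientAddGroup.mk_surjective q
  obtain ⟨c, rfl⟩ := alpha_gen d v
  exact ⟨_, comb_snd d B γ c⟩

theorem eq_add_p (hsum : (∑ i, γ i) = (B.index : ℤ))
    (hadm : ∀ m' : Fin (d + 1) → ℤ, (∑ i, m' i • alpha d i) ∈ B →
      (B.index : ℤ) ∣ ∑ i, m' i * γ i) (g h : GB d B γ)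
    (hgh : (g : ℤ × (L d ⧸ B)).2 = (h : ℤ × (L d ⧸ B)).2) : ∃ n : ℤ, h = g + n • pE d B γ := by
  obtain ⟨c, hc⟩ := GB_gen d B γ (h - g)
  have h2 := comb_snd d B γ c
  have h1 := comb_fst d B γ c
  rw [← hc] at h1 h2
  have h3 : QuotientAddGroup.mk (∑ i, c i • alpha d i) = (0 : L d ⧸ B) := by
    rw [← h2]; simp [hgh]
  obtain ⟨n, hn⟩ := hadm c ((QuotientAddGroup.eq_zero_iff _).1 h3)
  refine ⟨n, Subtype.ext (Prod.ext ?_ ?_)⟩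
  · have hp := pE_fst d B γ hsum
    simp only [AddSubgroup.coe_sub, Prod.fst_sub, AddSubgroup.coe_add, Prod.fst_add,
      AddSubgroup.coe_zsmul, Prod.smul_fst, smul_eq_mul, hp] at *
    linarith
  · simp [pE_snd, hgh]

theorem add_zsmul_fst (hsum : (∑ i, γ i) = (B.index : ℤ)) (g : GB d B γ) (n : ℤ) :
    ((g + n • pE d B γ : GB d B γ) : ℤ × (L d ⧸ B)).1 =
      (g : ℤ × (L d ⧸ B)).1 + n * B.index := by
  simp [pE_fst d B γ hsum]

theorem add_zsmul_snd (g : GB d B γ) (n : ℤ) :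
    ((g + n • pE d B γ : GB d B γ) : ℤ × (L d ⧸ B)).2 = (g : ℤ × (L d ⧸ B)).2 := by
  simp [pE_snd]

theorem mem_JofI_add (I : Set (GB d B γ)) (g : GB d B γ) (n : ℤ)
    (h : ∀ k : ℤ, g + k • pE d B γ ∈ I ↔ n ≤ k) (k : ℤ) :
    g + k • pE d B γ ∈ JofI (pE d B γ) I ↔ k = n := by
  have e : g + k • pE d B γ - pE d B γ = g + (k - 1) • pE d B γ := by
    rw [sub_smul, one_smul]; abel
  simp only [JofI, Set.mem_ofPred_eq, e, h]
  omega

/-- membership in an upper set in terms of its function. -/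
theorem mem_I_iff (hm : 0 < (B.index : ℤ)) (hsum : (∑ i, γ i) = (B.index : ℤ))
    (I : Set (GB d B γ)) (hI : IsUpper (xE d B γ) I)
    (hne : I.Nonempty) (hnu : I ≠ Set.univ) (f : L d ⧸ B → ℤ)
    (hf : IsFJ d B γ (JofI (pE d B γ) I) f) :
    ∃ N : ℤ, ∀ g : GB d B γ, g ∈ I ↔
      f (g : ℤ × (L d ⧸ B)).2 + N * B.index ≤ (g : ℤ × (L d ⧸ B)).1 := by
  have T := upper_threshold _ (GB_gen d B γ) I hI hne hnu
  obtain ⟨N, hN⟩ := T 0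
  refine ⟨N, fun g => ?_⟩
  obtain ⟨n, hn⟩ := T g
  have h0 := (mem_JofI_add d B γ I 0 N hN N).2 rfl
  rw [zero_add] at h0
  have h1 := hf N h0 _ ((mem_JofI_add d B γ I g n hn n).2 rfl)
  rw [add_zsmul_fst d B γ hsum, add_zsmul_snd] at h1
  have h2 := hn 0
  rw [zero_smul, add_zero] at h2
  rw [h2, h1]
  constructor
  · intro h; nlinarith
  · intro h
    by_contra hlt
    have : 0 < n * (B.index : ℤ) := mul_pos (by linarith) hm
    linarith

theorem detector_add (f : L d ⧸ B → ℤ) (hf : IsCutDetector d B f γ) (q : L d ⧸ B)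
    (i : Fin (d + 1)) : f (q + QuotientAddGroup.mk (alpha d i)) = f q + γ i ∨
      f (q + QuotientAddGroup.mk (alpha d i)) = f q + γ i - B.index := by
  obtain ⟨v, rfl⟩ := QuotientAddGroup.mk_surjective q
  exact hf.2 v i

theorem detector_cone (f : L d ⧸ B → ℤ) (hf : IsCutDetector d B f γ)
    (c : Fin (d + 1) → ℕ) (q : L d ⧸ B) (s : Finset (Fin (d + 1))) :
    f (q + QuotientAddGroup.mk (∑ i ∈ s, (c i : ℤ) • alpha d i)) ≤
      f q + ∑ i ∈ s, (c i : ℤ) * γ i := by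
  induction s using Finset.induction_on generalizing q with
  | empty => simp
  | insert a s ha ih =>
    rw [Finset.sum_insert ha, Finset.sum_insert ha, QuotientAddGroup.mk_add, ← add_assoc]
    have key : ∀ k : ℕ, f (q + QuotientAddGroup.mk ((k : ℤ) • alpha d a)) ≤ f q + k * γ a := by
      intro k
      induction k with
      | zero => simp
      | succ k ihk =>
        have e : q + QuotientAddGroup.mk (((k + 1 : ℕ) : ℤ) • alpha d a) =
          (q + QuotientAddGroup.mk ((k : ℤ) • alpha d a)) +
            (QuotientAddGroup.mk (alpha d a) : L d ⧸ B) := by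
          rw [add_assoc, ← QuotientAddGroup.mk_add]; congr 2; push_cast; rw [add_smul, one_smul]
        rw [e]
        have := detector_add d B γ f hf (q + QuotientAddGroup.mk ((k : ℤ) • alpha d a)) a
        push_cast
        have hm : (0 : ℤ) ≤ B.index := by positivity
        rcases this with h | h <;> rw [h] <;> linarith
    have := ih (q + QuotientAddGroup.mk ((c a : ℤ) • alpha d a))
    have := key (c a)
    linarith

theorem detector_mod (f : L d ⧸ B → ℤ) (hf : IsCutDetector d B f γ) (g : GB d B γ) :
    (B.index : ℤ) ∣ f (g : ℤ × (L d ⧸ B)).2 - (g : ℤ × (L d ⧸ B)).1 := by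
  -- the set of translations preserving the residue is a subgroup
  let H : AddSubgroup (GB d B γ) :=
    { carrier := {t | ∀ h : GB d B γ, (B.index : ℤ) ∣
        (f ((h + t : GB d B γ) : ℤ × (L d ⧸ B)).2 - ((h + t : GB d B γ) : ℤ × (L d ⧸ B)).1) -
          (f (h : ℤ × (L d ⧸ B)).2 - (h : ℤ × (L d ⧸ B)).1)}
      zero_mem' := fun h => by simp
      add_mem' := fun {a b} ha hb h => by
        have := dvd_add (ha h) (hb (h + a))
        rw [sub_add_sub_cancel', add_assoc] at this
        exact this
      neg_mem' := fun {a} ha h => by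
        have := ha (h + -a)
        rw [neg_add_cancel_right] at this
        rw [← dvd_neg, neg_sub]
        exact this }
  have hx : ∀ i, xE d B γ i ∈ H := by
    intro i h
    have := detector_add d B γ f hf (h : ℤ × (L d ⧸ B)).2 i
    simp only [AddSubgroup.coe_add, Prod.fst_add, Prod.snd_add, xE_fst, xE_snd]
    rcases this with e | e <;> rw [e]
    · exact ⟨0, by ring⟩
    · exact ⟨-1, by ring⟩
  have hg : g ∈ H := by
    obtain ⟨c, rfl⟩ := GB_gen d B γ g
    exact H.sum_mem fun i _ => H.zsmul_mem (hx i) _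
  have := hg 0
  simpa [hf.1] using this

theorem part_one (hsum : (∑ i, γ i) = (B.index : ℤ))
    (hadm : ∀ m' : Fin (d + 1) → ℤ, (∑ i, m' i • alpha d i) ∈ B →
      (B.index : ℤ) ∣ ∑ i, m' i * γ i)
    (I : Set (GB d B γ)) (hI : IsUpper (xE d B γ) I) (hne : I.Nonempty) (hnu : I ≠ Set.univ) :
    InJ d B γ (JofI (pE d B γ) I) ∧
      ∃ f : L d ⧸ B → ℤ, IsFJ d B γ (JofI (pE d B γ) I) f ∧ IsCutDetector d B f γ := by
  have T := upper_threshold _ (GB_gen d B γ) I hI hne hnu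
  have hJ : InJ d B γ (JofI (pE d B γ) I) := by
    refine ⟨fun g => ?_, fun g hg i => ?_⟩
    · obtain ⟨n, hn⟩ := T g
      have := mem_JofI_add d B γ I g n hn
      exact ⟨n, (this n).2 rfl, fun k hk => (this k).1 hk⟩
    · by_cases h : g + xE d B γ i - pE d B γ ∈ I
      · refine Or.inr ⟨h, fun h' => hg.2 (hI _ h' _ ?_)⟩
        rw [show g - pE d B γ - (g + xE d B γ i - pE d B γ - pE d B γ) =
          pE d B γ - xE d B γ i by abel]
        exact p_sub_x_mem_cone _ i
      · refine Or.inl ⟨hI _ hg.1 _ ?_, h⟩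
        rw [add_sub_cancel_left]
        exact x_mem_cone _ i
  refine ⟨hJ, ?_⟩
  obtain ⟨N, hN⟩ := T 0
  have hN' := mem_JofI_add d B γ I 0 N hN
  simp only [zero_add] at hN'
  have hover : ∀ q : L d ⧸ B, ∃ g : GB d B γ, g ∈ JofI (pE d B γ) I ∧
      (g : ℤ × (L d ⧸ B)).2 = q := by
    intro q
    obtain ⟨g, rfl⟩ := exists_over d B γ q
    obtain ⟨n, hn, -⟩ := hJ.1 g
    exact ⟨_, hn, add_zsmul_snd d B γ g n⟩
  choose s hs hs2 using hover
  have huniq : ∀ g ∈ JofI (pE d B γ) I, s (g : ℤ × (L d ⧸ B)).2 = g := by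
    intro g hg
    obtain ⟨n, hn⟩ := eq_add_p d B γ hsum hadm g (s (g : ℤ × (L d ⧸ B)).2) (hs2 _).symm
    have h1 := hs (g : ℤ × (L d ⧸ B)).2
    rw [hn] at h1
    have : n = 0 := (hJ.1 g).unique h1 (by simpa using hg)
    rw [hn, this]; simp
  refine ⟨fun q => (s q : ℤ × (L d ⧸ B)).1 - N * B.index, ?_, ?_, ?_⟩
  · intro n hn g hg
    rw [(hN' n).1 hn]
    simp only [huniq g hg]
  · have h0 := huniq _ ((hN' N).2 rfl)
    have e2 := add_zsmul_snd d B γ 0 N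
    have e1 := add_zsmul_fst d B γ hsum 0 N
    simp only [zero_add] at e1 e2
    rw [e2] at h0
    have h0' : s 0 = N • pE d B γ := h0
    simp only [h0', e1]
    simp
  · intro x i
    have key : ∀ t : GB d B γ, t ∈ JofI (pE d B γ) I →
        (t : ℤ × (L d ⧸ B)).2 = QuotientAddGroup.mk (x + alpha d i) →
        s (QuotientAddGroup.mk (x + alpha d i)) = t := by
      intro t ht h; rw [← h]; exact huniq t ht
    rcases hJ.2 _ (hs (QuotientAddGroup.mk x)) i with h | h
    · left
      show (s _ : ℤ × (L d ⧸ B)).1 - _ = (s _ : ℤ × (L d ⧸ B)).1 - _ + γ i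
      rw [key _ h (by simp [hs2, xE_snd])]
      simp only [AddSubgroup.coe_add, Prod.fst_add, xE_fst]
      ring
    · right
      show (s _ : ℤ × (L d ⧸ B)).1 - _ = (s _ : ℤ × (L d ⧸ B)).1 - _ + γ i - _
      rw [key _ h (by simp [hs2, xE_snd, pE_snd])]
      simp only [AddSubgroup.coe_add, AddSubgroup.coe_sub, Prod.fst_add, Prod.fst_sub, xE_fst,
        pE_fst d B γ hsum]
      ring

end

theorem cut_upper_set_correspondence (d : ℕ) (hd : 1 ≤ d) (B : AddSubgroup (L d))
    [B.FiniteIndex] (γ : Fin (d + 1) → ℤ) (hγ : ∀ i, 0 < γ i)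
    (hsum : (∑ i, γ i) = (B.index : ℤ))
    (hadm : ∀ m' : Fin (d + 1) → ℤ, (∑ i, m' i • alpha d i) ∈ B →
      (B.index : ℤ) ∣ ∑ i, m' i * γ i) :
    (∀ I : Set (GB d B γ), IsUpper (xE d B γ) I → I.Nonempty → I ≠ Set.univ →
      InJ d B γ (JofI (pE d B γ) I) ∧
      ∃ f : L d ⧸ B → ℤ, IsFJ d B γ (JofI (pE d B γ) I) f ∧ IsCutDetector d B f γ) ∧
    (∀ f : L d ⧸ B → ℤ, IsCutDetector d B f γ →
      ∃ I : Set (GB d B γ), IsUpper (xE d B γ) I ∧ I.Nonempty ∧ I ≠ Set.univ ∧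
        IsFJ d B γ (JofI (pE d B γ) I) f) ∧
    (∀ I I' : Set (GB d B γ),
      IsUpper (xE d B γ) I → I.Nonempty → I ≠ Set.univ →
      IsUpper (xE d B γ) I' → I'.Nonempty → I' ≠ Set.univ →
      ((∃ f : L d ⧸ B → ℤ,
          IsFJ d B γ (JofI (pE d B γ) I) f ∧ IsFJ d B γ (JofI (pE d B γ) I') f) ↔
        ∃ n : ℤ, I' = (fun g => g + n • pE d B γ) '' I)) := by
  have hm : 0 < (B.index : ℤ) := by
    rw [← hsum]
    exact Finset.sum_pos (fun i _ => hγ i) Finset.univ_nonempty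
  refine ⟨part_one d B γ hsum hadm, ?_, ?_⟩
  · intro f hf
    have hp1 := pE_fst d B γ hsum
    have hp2 := pE_snd d B γ
    refine ⟨{g | f (g : ℤ × (L d ⧸ B)).2 ≤ (g : ℤ × (L d ⧸ B)).1}, ?_, ⟨0, ?_⟩, ?_, ?_⟩
    · rintro g hg h ⟨c, hc⟩
      have e : h = g + ∑ i, (c i : ℤ) • xE d B γ i := by rw [← hc]; abel
      have h1 := comb_fst d B γ (fun i => (c i : ℤ))
      have h2 := comb_snd d B γ (fun i => (c i : ℤ))
      have h3 := detector_cone d B γ f hf c (g : ℤ × (L d ⧸ B)).2 Finset.univ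
      simp only [Set.mem_ofPred_eq] at hg ⊢
      rw [e, AddSubgroup.coe_add, Prod.fst_add, Prod.snd_add, h1, h2]
      linarith
    · simp [hf.1]
    · rw [Set.ne_univ_iff_exists_notMem]
      refine ⟨-pE d B γ, ?_⟩
      simp only [Set.mem_ofPred_eq, AddSubgroup.coe_neg, Prod.fst_neg, Prod.snd_neg, hp1, hp2,
        neg_zero, hf.1]
      linarith
    · have key : ∀ g ∈ JofI (pE d B γ)
          {g : GB d B γ | f (g : ℤ × (L d ⧸ B)).2 ≤ (g : ℤ × (L d ⧸ B)).1},
          f (g : ℤ × (L d ⧸ B)).2 = (g : ℤ × (L d ⧸ B)).1 := by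
        rintro g ⟨h1, h2⟩
        simp only [Set.mem_ofPred_eq, AddSubgroup.coe_sub, Prod.fst_sub, Prod.snd_sub, hp1, hp2,
          sub_zero, not_le] at h1 h2
        have h3 := detector_mod d B γ f hf g
        rw [← dvd_neg, neg_sub] at h3
        have := Int.eq_zero_of_dvd_of_nonneg_of_lt (by linarith) (by linarith) h3
        linarith
      intro n hn g hg
      have h0 := key _ hn
      have e2 := add_zsmul_snd d B γ 0 n
      have e1 := add_zsmul_fst d B γ hsum 0 n
      rw [zero_add] at e1 e2
      rw [e1, e2] at h0
      simp only [ZeroMemClass.coe_zero, Prod.fst_zero, Prod.snd_zero, hf.1, zero_add] at h0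
      rw [key g hg, ← h0, sub_zero]
  · intro I I' hI hne hnu hI' hne' hnu'
    constructor
    · rintro ⟨f, hf, hf'⟩
      obtain ⟨N, hN⟩ := mem_I_iff d B γ hm hsum I hI hne hnu f hf
      obtain ⟨N', hN'⟩ := mem_I_iff d B γ hm hsum I' hI' hne' hnu' f hf'
      refine ⟨N' - N, ?_⟩
      ext g
      constructor
      · intro hg
        refine ⟨g + (-(N' - N)) • pE d B γ, ?_, ?_⟩
        · rw [hN, add_zsmul_fst d B γ hsum, add_zsmul_snd]
          have := (hN' g).1 hg
          linarith
        · show g + (-(N' - N)) • pE d B γ + (N' - N) • pE d B γ = g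
          rw [neg_zsmul, neg_add_cancel_right]
      · rintro ⟨h, hh, rfl⟩
        simp only
        rw [hN', add_zsmul_fst d B γ hsum, add_zsmul_snd]
        have := (hN h).1 hh
        linarith
    · rintro ⟨n, rfl⟩
      obtain ⟨-, f, hf, -⟩ := part_one d B γ hsum hadm I hI hne hnu
      refine ⟨f, hf, ?_⟩
      have key : ∀ g, g ∈ JofI (pE d B γ) ((fun g => g + n • pE d B γ) '' I) →
          g + (-n) • pE d B γ ∈ JofI (pE d B γ) I := by
        rintro g ⟨⟨h, hh, rfl⟩, h2⟩
        simp only [neg_smul, add_neg_cancel_right]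
        refine ⟨hh, fun h3 => h2 ⟨_, h3, ?_⟩⟩
        simp only
        abel
      intro k hk g hg
      have h1 := key _ hk
      rw [← add_zsmul] at h1
      have h2 := hf _ h1 _ (key g hg)
      rw [add_zsmul_fst d B γ hsum, add_zsmul_snd] at h2
      rw [h2]
      ring

end Paper
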